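/- arXiv:math/0404549 — 4 statements merged into one kernel-verified Lean document; each statement's English description precedes it below -/
import Mathlib

section
/- ker(γ), with the subspace topology inherited from the 2ℓ×2ℓ real matrices, is homotopy equivalent to GL₊(k,ℝ) (the k×k real matrices of positive determinant, with its usual topology); in particular ker(γ) is connected. -/
open Matrix

/-- Half index type: `Fin k ⊕ Fin m` with `m = ℓ - k`. -/
abbrev HalfIdx (k m : ℕ) := Fin k ⊕ Fin m

/-- Full index type for `2ℓ × 2ℓ` matrices, in block form `(k, m, k, m)`. -/
abbrev FullIdx (k m : ℕ) := HalfIdx k m ⊕ HalfIdx k m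

/-- The standard symplectic matrix `J = [[0, I], [-I, 0]]`. -/
def Jmat (k m : ℕ) : Matrix (FullIdx k m) (FullIdx k m) ℝ :=
  Matrix.fromBlocks 0 1 (-1) 0

/-- The symplectic group `Sp(ℓ)`: matrices with `Mᵀ J M = J`. -/
def SpBig (k m : ℕ) : Set (Matrix (FullIdx k m) (FullIdx k m) ℝ) :=
  {M | Mᵀ * Jmat k m * M = Jmat k m}

def Jsmall (m : ℕ) : Matrix (Fin m ⊕ Fin m) (Fin m ⊕ Fin m) ℝ :=
  Matrix.fromBlocks 0 1 (-1) 0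

/-- The symplectic group `Sp(ℓ-k)`. -/
def SpSmall (m : ℕ) : Set (Matrix (Fin m ⊕ Fin m) (Fin m ⊕ Fin m) ℝ) :=
  {S | Sᵀ * Jsmall m * S = Jsmall m}

/-- Embedding of block indices `1..4` of sizes `k, m, k, m`. -/
def r1 (k m : ℕ) : Fin k → FullIdx k m := fun i => Sum.inl (Sum.inl i)
def r2 (k m : ℕ) : Fin m → FullIdx k m := fun i => Sum.inl (Sum.inr i)
def r3 (k m : ℕ) : Fin k → FullIdx k m := fun i => Sum.inr (Sum.inl i)
def r4 (k m : ℕ) : Fin m → FullIdx k m := fun i => Sum.inr (Sum.inr i)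

/-- Embedding of the indices `{k+1,…,ℓ} ∪ {ℓ+k+1,…,2ℓ}`. -/
def embSmall (k m : ℕ) : Fin m ⊕ Fin m → FullIdx k m :=
  Sum.elim (fun i => Sum.inl (Sum.inr i)) (fun i => Sum.inr (Sum.inr i))

/-- The upper-left `k × k` block `A₁`. -/
def blk1 (k m : ℕ) (M : Matrix (FullIdx k m) (FullIdx k m) ℝ) : Matrix (Fin k) (Fin k) ℝ :=
  M.submatrix (r1 k m) (r1 k m)

/-- The `2(ℓ-k) × 2(ℓ-k)` submatrix `A₂`. -/
def blk2 (k m : ℕ) (M : Matrix (FullIdx k m) (FullIdx k m) ℝ) :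
    Matrix (Fin m ⊕ Fin m) (Fin m ⊕ Fin m) ℝ :=
  M.submatrix (embSmall k m) (embSmall k m)

/-- `Sp(k,ℓ)`: symplectic matrices with `a_{ij} = 0` for `1 ≤ j ≤ k` and `i > k`. -/
def SpKL (k m : ℕ) : Set (Matrix (FullIdx k m) (FullIdx k m) ℝ) :=
  {M | M ∈ SpBig k m ∧
    ∀ (i : FullIdx k m) (j : Fin k), (∀ i' : Fin k, i ≠ r1 k m i') → M i (r1 k m j) = 0}

/-- The kernel `T` of `ϖ : Sp(k,ℓ) → GL(k,ℝ) × Sp(ℓ-k)`. -/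
def kerVarpi (k m : ℕ) : Set (Matrix (FullIdx k m) (FullIdx k m) ℝ) :=
  {M | M ∈ SpKL k m ∧ blk1 k m M = 1 ∧ blk2 k m M = 1}

/-- `Sp₊(k,ℓ)`: elements of `Sp(k,ℓ)` with `det A₁ > 0`. -/
def SpPlus (k m : ℕ) : Set (Matrix (FullIdx k m) (FullIdx k m) ℝ) :=
  {M | M ∈ SpKL k m ∧ 0 < (blk1 k m M).det}

/-- The kernel of `γ : Sp₊(k,ℓ) → Sp(ℓ-k)`, the second component of `ϖ`. -/
def kerGamma (k m : ℕ) : Set (Matrix (FullIdx k m) (FullIdx k m) ℝ) :=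
  {M | M ∈ SpPlus k m ∧ blk2 k m M = 1}

section PositiveDeterminant

variable {n : Type*} [DecidableEq n]

/-- The diagonal matrix with `a` in position `i` and `1` elsewhere. -/
def diagAt (i : n) (a : ℝ) : Matrix n n ℝ :=
  diagonal (Function.update 1 i a)

theorem diagAt_one (i : n) : diagAt i 1 = 1 := by
  rw [diagAt, ← diagonal_one]
  congr 1
  exact Function.update_eq_self i (1 : n → ℝ)

variable [Fintype n]

/-- The set of real matrices of positive determinant. -/
abbrev posDet (n : Type*) [Fintype n] [DecidableEq n] : Set (Matrix n n ℝ) :=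
  {A | 0 < A.det}

theorem joinedIn_posDet_mul {A B C D : Matrix n n ℝ} (h : JoinedIn (posDet n) A B)
    (h' : JoinedIn (posDet n) C D) : JoinedIn (posDet n) (A * C) (B * D) := by
  refine (h.mul h').mono ?_
  rintro _ ⟨X, hX, Y, hY, rfl⟩
  simpa only [Set.mem_ofPred_eq, det_mul] using mul_pos hX hY

theorem joinedIn_one_mul {A B : Matrix n n ℝ} (hA : JoinedIn (posDet n) 1 A)
    (hB : JoinedIn (posDet n) 1 B) : JoinedIn (posDet n) 1 (A * B) := by
  simpa using joinedIn_posDet_mul hA hB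

theorem joinedIn_one_transvection {i j : n} (hij : i ≠ j) (c : ℝ) :
    JoinedIn (posDet n) 1 (transvection i j c) := by
  refine JoinedIn.ofLine (f := fun t : ℝ => transvection i j (t * c)) ?_ (by simp) (by simp) ?_
  · refine Continuous.continuousOn (continuous_pi fun a => continuous_pi fun b => ?_)
    simp only [transvection, Matrix.add_apply, single_apply]
    split_ifs <;> fun_prop
  · rintro _ ⟨t, -, rfl⟩
    simp [det_transvection_of_ne i j hij]

theorem det_diagAt (i : n) (a : ℝ) : (diagAt i a).det = a := by
  simp [diagAt, det_diagonal, Finset.prod_update_of_mem (Finset.mem_univ i)]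

theorem diagAt_mul (i : n) (a b : ℝ) : diagAt i a * diagAt i b = diagAt i (a * b) := by
  rw [diagAt, diagAt, diagAt, diagonal_mul_diagonal]
  congr 1
  ext x
  by_cases h : x = i
  · subst h; simp
  · simp [h]

theorem joinedIn_one_diagAt (i : n) {a : ℝ} (ha : 0 < a) :
    JoinedIn (posDet n) 1 (diagAt i a) := by
  refine JoinedIn.ofLine (f := fun t : ℝ => diagAt i (1 + t * (a - 1))) ?_
    (by simp [diagAt_one]) (by simp) ?_
  · refine Continuous.continuousOn (Continuous.matrix_diagonal ?_)
    exact continuous_const.update i (by fun_prop)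
  · rintro _ ⟨t, ⟨h0, h1⟩, rfl⟩
    simp only [Set.mem_ofPred_eq, det_diagAt]
    nlinarith [mul_nonneg h0 ha.le]

theorem diagAt_neg_one_mul {i j : n} (hij : i ≠ j) :
    diagAt i (-1) * diagAt j (-1) =
      (transvection i j 1 * transvection j i (-1) * transvection i j 1) *
        (transvection i j 1 * transvection j i (-1) * transvection i j 1) := by
  have hd : ∀ l : n, diagAt l (-1) = 1 - 2 • single l l 1 := by
    intro l
    ext a b
    by_cases hab : a = b
    · subst hab
      by_cases hl : a = l
      · subst hl; simp [diagAt]; norm_num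
      · simp [diagAt, hl, Ne.symm hl]
    · have : ¬ (l = a ∧ l = b) := fun h => hab (h.1.symm.trans h.2)
      simp [diagAt, hab, this]
  have hneg : single j i (-1 : ℝ) = -single j i 1 := by
    ext a b
    simp only [single_apply, Matrix.neg_apply]
    split_ifs <;> simp
  rw [hd, hd, transvection, transvection, hneg]
  simp only [mul_add, add_mul, mul_sub, sub_mul, mul_one, one_mul, mul_neg, neg_mul, smul_mul_assoc,
    mul_smul_comm, single_mul_single_same, single_mul_single_of_ne _ _ _ _ hij, mul_zero, zero_mul,
    single_mul_single_of_ne _ _ _ _ hij.symm]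
  abel

theorem joinedIn_one_diagAt_neg_one_mul (i j : n) :
    JoinedIn (posDet n) 1 (diagAt i (-1) * diagAt j (-1)) := by
  by_cases hij : i = j
  · subst hij
    rw [diagAt_mul, neg_mul_neg, one_mul]
    exact joinedIn_one_diagAt i one_pos
  · rw [diagAt_neg_one_mul hij]
    have h := joinedIn_one_mul (joinedIn_one_mul (joinedIn_one_transvection hij 1)
      (joinedIn_one_transvection (Ne.symm hij) (-1))) (joinedIn_one_transvection hij 1)
    exact joinedIn_one_mul h h

theorem joinedIn_one_reflect_conj (i : n) {A : Matrix n n ℝ} (hA : JoinedIn (posDet n) 1 A) :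
    JoinedIn (posDet n) 1 (diagAt i (-1) * A * diagAt i (-1)) := by
  have h := hA.map (f := fun X => diagAt i (-1) * X * diagAt i (-1)) (by fun_prop)
  simp only [mul_one, diagAt_mul, neg_mul_neg, diagAt_one] at h
  refine h.mono ?_
  rintro _ ⟨X, hX, rfl⟩
  simpa [det_mul, det_diagAt] using hX

/-- `A` lies in the identity component up to the reflection in the coordinate `i`. -/
def IsJoinedUpToReflection (i : n) (A : Matrix n n ℝ) : Prop :=
  JoinedIn (posDet n) 1 A ∨ JoinedIn (posDet n) 1 (A * diagAt i (-1))

theorem IsJoinedUpToReflection.mul {i : n} {A B : Matrix n n ℝ}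
    (hA : IsJoinedUpToReflection i A) (hB : IsJoinedUpToReflection i B) :
    IsJoinedUpToReflection i (A * B) := by
  have hs : diagAt i (-1) * diagAt i (-1) = (1 : Matrix n n ℝ) := by
    rw [diagAt_mul, neg_mul_neg, one_mul, diagAt_one]
  rcases hA with hA | hA <;> rcases hB with hB | hB
  · exact Or.inl (joinedIn_one_mul hA hB)
  · right
    rw [mul_assoc]
    exact joinedIn_one_mul hA hB
  · right
    have h := joinedIn_one_mul hA (joinedIn_one_reflect_conj i hB)
    rwa [show A * diagAt i (-1) * (diagAt i (-1) * B * diagAt i (-1)) =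
      A * (diagAt i (-1) * diagAt i (-1)) * B * diagAt i (-1) by simp only [mul_assoc], hs,
      mul_one] at h
  · left
    have h := joinedIn_one_mul hA (joinedIn_one_reflect_conj i hB)
    rwa [show A * diagAt i (-1) * (diagAt i (-1) * (B * diagAt i (-1)) * diagAt i (-1)) =
      A * (diagAt i (-1) * diagAt i (-1)) * B * (diagAt i (-1) * diagAt i (-1)) by
        simp only [mul_assoc], hs, mul_one, mul_one] at h

theorem isJoinedUpToReflection_diagAt (i j : n) {a : ℝ} (ha : a ≠ 0) :
    IsJoinedUpToReflection i (diagAt j a) := by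
  rcases ha.lt_or_gt with h | h
  · rw [show a = -a * -1 by ring, ← diagAt_mul]
    exact IsJoinedUpToReflection.mul (Or.inl (joinedIn_one_diagAt j (by linarith)))
      (Or.inr (joinedIn_one_diagAt_neg_one_mul j i))
  · exact Or.inl (joinedIn_one_diagAt j h)

theorem isJoinedUpToReflection_one (i : n) : IsJoinedUpToReflection i (1 : Matrix n n ℝ) :=
  Or.inl (JoinedIn.refl (by simp))

theorem isJoinedUpToReflection_diagonal (i : n) {d : n → ℝ} (hd : ∀ j, d j ≠ 0) :
    IsJoinedUpToReflection i (diagonal d) := by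
  have key : ∀ s : Finset n,
      IsJoinedUpToReflection i (diagonal fun j => if j ∈ s then d j else 1) := by
    intro s
    induction s using Finset.induction_on with
    | empty => simpa using isJoinedUpToReflection_one i
    | insert a s ha ih =>
      have h := (isJoinedUpToReflection_diagAt i a (hd a)).mul ih
      rw [diagAt, diagonal_mul_diagonal] at h
      convert h using 1
      congr 1
      funext j
      by_cases hj : j = a
      · subst hj; simp [ha]
      · simp [hj]
  simpa using key Finset.univ

theorem isJoinedUpToReflection_of_det_ne_zero (i : n) {A : Matrix n n ℝ} (hA : A.det ≠ 0) :
    IsJoinedUpToReflection i A := by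
  refine diagonal_transvection_induction_of_det_ne_zero _ A hA (fun d hd => ?_) (fun t => ?_)
    fun A B _ _ hA hB => hA.mul hB
  · rw [det_diagonal, Finset.prod_ne_zero_iff] at hd
    exact isJoinedUpToReflection_diagonal i fun j => hd j (Finset.mem_univ j)
  · exact Or.inl (joinedIn_one_transvection t.hij t.c)

/-- The group `GL₊(n, ℝ)` is path connected. -/
theorem isPathConnected_posDet [Nonempty n] : IsPathConnected (posDet n) := by
  refine ⟨1, by simp, fun {A} hA => ?_⟩
  have hA' : 0 < A.det := hA
  obtain ⟨i⟩ := ‹Nonempty n›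
  refine (isJoinedUpToReflection_of_det_ne_zero i hA'.ne').resolve_right fun h => ?_
  have := h.target_mem
  simp only [Set.mem_ofPred_eq, det_mul, det_diagAt] at this
  linarith

theorem continuous_inv_posDet : Continuous fun A : posDet n => (A : Matrix n n ℝ)⁻¹ := by
  simp only [inv_def, Ring.inverse_eq_inv']
  exact (Continuous.inv₀ (Continuous.matrix_det continuous_subtype_val) fun A => A.2.ne').smul
    (Continuous.matrix_adjugate continuous_subtype_val)

end PositiveDeterminant

section KernelOfGamma

variable {k m : ℕ}

theorem fromBlocks_mem_SpBig_iff {P Q R S : Matrix (HalfIdx k m) (HalfIdx k m) ℝ} :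
    fromBlocks P Q R S ∈ SpBig k m ↔
      Pᵀ * R = Rᵀ * P ∧ Pᵀ * S = 1 + Rᵀ * Q ∧ Qᵀ * S = Sᵀ * Q := by
  have h : fromBlocks P Q R S ∈ SpBig k m ↔
      -(Rᵀ * P) + Pᵀ * R = 0 ∧ -(Rᵀ * Q) + Pᵀ * S = 1 ∧
        -(Sᵀ * P) + Qᵀ * R = -1 ∧ -(Sᵀ * Q) + Qᵀ * S = 0 := by
    simp [SpBig, Jmat, fromBlocks_transpose, fromBlocks_multiply, fromBlocks_inj]
  rw [h]
  constructor
  · rintro ⟨h1, h2, -, h4⟩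
    exact ⟨(neg_add_eq_zero.mp h1).symm, by rw [← h2]; abel, (neg_add_eq_zero.mp h4).symm⟩
  · rintro ⟨h1, h2, h4⟩
    refine ⟨by rw [h1]; abel, by rw [h2]; abel, ?_, by rw [h4]; abel⟩
    have h3 := congrArg transpose h2
    simp only [transpose_mul, transpose_transpose, transpose_add, transpose_one] at h3
    rw [h3]
    abel

/-- The block shape of the elements of `kerGamma k m`. -/
def kerBlocks (A : Matrix (Fin k) (Fin k) ℝ) (B : Matrix (Fin k) (Fin m) ℝ)
    (C : Matrix (Fin k) (Fin k) ℝ) (D : Matrix (Fin k) (Fin m) ℝ)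
    (E : Matrix (Fin m) (Fin k) ℝ) (G : Matrix (Fin k) (Fin k) ℝ)
    (K : Matrix (Fin m) (Fin k) ℝ) : Matrix (FullIdx k m) (FullIdx k m) ℝ :=
  fromBlocks (fromBlocks A B 0 1) (fromBlocks C D E 0) 0 (fromBlocks G 0 K 1)

theorem kerBlocks_mem_SpBig_iff {A : Matrix (Fin k) (Fin k) ℝ} {B : Matrix (Fin k) (Fin m) ℝ}
    {C : Matrix (Fin k) (Fin k) ℝ} {D : Matrix (Fin k) (Fin m) ℝ}
    {E : Matrix (Fin m) (Fin k) ℝ} {G : Matrix (Fin k) (Fin k) ℝ}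
    {K : Matrix (Fin m) (Fin k) ℝ} :
    kerBlocks A B C D E G K ∈ SpBig k m ↔
      Aᵀ * G = 1 ∧ Bᵀ * G + K = 0 ∧ Dᵀ * G = E ∧
        Cᵀ * G + Eᵀ * K = Gᵀ * C + Kᵀ * E := by
  rw [kerBlocks, fromBlocks_mem_SpBig_iff]
  simp only [fromBlocks_transpose, fromBlocks_multiply, ← fromBlocks_one (l := Fin k) (m := Fin m),
    fromBlocks_inj, transpose_zero, transpose_one, Matrix.mul_zero, Matrix.zero_mul,
    Matrix.mul_one, Matrix.one_mul, add_zero, zero_add, true_and, and_true]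
  constructor
  · rintro ⟨⟨hG, hK⟩, hC, -, hE⟩
    exact ⟨hG, hK, hE, hC⟩
  · rintro ⟨hG, hK, h3, hC⟩
    refine ⟨⟨hG, hK⟩, hC, ?_, h3⟩
    rw [← h3, transpose_mul, transpose_transpose]

theorem kerBlocks_mem_kerGamma_iff {A : Matrix (Fin k) (Fin k) ℝ} {B : Matrix (Fin k) (Fin m) ℝ}
    {C : Matrix (Fin k) (Fin k) ℝ} {D : Matrix (Fin k) (Fin m) ℝ}
    {E : Matrix (Fin m) (Fin k) ℝ} {G : Matrix (Fin k) (Fin k) ℝ}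
    {K : Matrix (Fin m) (Fin k) ℝ} :
    kerBlocks A B C D E G K ∈ kerGamma k m ↔
      kerBlocks A B C D E G K ∈ SpBig k m ∧ 0 < A.det := by
  have hzero : ∀ (i : FullIdx k m) (j : Fin k), (∀ i' : Fin k, i ≠ r1 k m i') →
      kerBlocks A B C D E G K i (r1 k m j) = 0 := by
    rintro ((i | i) | (i | i)) j h
    · exact absurd rfl (h i)
    all_goals rfl
  have hblk : blk2 k m (kerBlocks A B C D E G K) = 1 := by
    ext (i | i) (j | j) <;> simp [blk2, embSmall, kerBlocks, one_apply]
  exact ⟨fun h => ⟨h.1.1.1, h.1.2⟩, fun h => ⟨⟨⟨h.1, hzero⟩, h.2⟩, hblk⟩⟩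

/-- Replace the blocks of `M` that are fixed on `kerGamma k m` by their values there, and scale
the blocks `B`, `D`, `E`, `K` by `t` and `C` by `t ^ 2`. -/
def kerScale (t : ℝ) (M : Matrix (FullIdx k m) (FullIdx k m) ℝ) :
    Matrix (FullIdx k m) (FullIdx k m) ℝ :=
  kerBlocks (blk1 k m M) (t • M.submatrix (r1 k m) (r2 k m))
    (t ^ 2 • M.submatrix (r1 k m) (r3 k m)) (t • M.submatrix (r1 k m) (r4 k m))
    (t • M.submatrix (r2 k m) (r3 k m)) (M.submatrix (r3 k m) (r3 k m))
    (t • M.submatrix (r4 k m) (r3 k m))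

theorem kerScale_one {M : Matrix (FullIdx k m) (FullIdx k m) ℝ} (hM : M ∈ kerGamma k m) :
    kerScale 1 M = M := by
  obtain ⟨⟨⟨hSp, hzero⟩, hdet⟩, hblk⟩ := hM
  set A := blk1 k m M
  have hA' : IsUnit Aᵀ.det := by rw [det_transpose]; exact hdet.ne'.isUnit
  have h21 : M.submatrix (r2 k m) (r1 k m) = 0 := by
    ext i j; exact hzero _ j (by simp [r1, r2])
  have h31 : M.submatrix (r3 k m) (r1 k m) = 0 := by
    ext i j; exact hzero _ j (by simp [r1, r3])
  have h41 : M.submatrix (r4 k m) (r1 k m) = 0 := by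
    ext i j; exact hzero _ j (by simp [r1, r4])
  have hb : ∀ a b, M (embSmall k m a) (embSmall k m b) = (1 : Matrix _ _ ℝ) a b :=
    fun a b => congrFun (congrFun hblk a) b
  have h22 : M.submatrix (r2 k m) (r2 k m) = 1 := by
    ext i j; exact (hb (.inl i) (.inl j)).trans (by simp [one_apply])
  have h24 : M.submatrix (r2 k m) (r4 k m) = 0 := by
    ext i j; exact hb (.inl i) (.inr j)
  have h42 : M.submatrix (r4 k m) (r2 k m) = 0 := by
    ext i j; exact hb (.inr i) (.inl j)
  have h44 : M.submatrix (r4 k m) (r4 k m) = 1 := by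
    ext i j; exact (hb (.inr i) (.inr j)).trans (by simp [one_apply])
  have hM : M = fromBlocks
      (fromBlocks A (M.submatrix (r1 k m) (r2 k m)) 0 1)
      (fromBlocks (M.submatrix (r1 k m) (r3 k m)) (M.submatrix (r1 k m) (r4 k m))
        (M.submatrix (r2 k m) (r3 k m)) 0)
      (fromBlocks 0 (M.submatrix (r3 k m) (r2 k m)) 0 0)
      (fromBlocks (M.submatrix (r3 k m) (r3 k m)) (M.submatrix (r3 k m) (r4 k m))
        (M.submatrix (r4 k m) (r3 k m)) 1) := by
    ext ((i | i) | (i | i)) ((j | j) | (j | j))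
    all_goals first
      | rfl
      | exact congrFun (congrFun h21 i) j
      | exact congrFun (congrFun h31 i) j
      | exact congrFun (congrFun h41 i) j
      | exact congrFun (congrFun h22 i) j
      | exact congrFun (congrFun h24 i) j
      | exact congrFun (congrFun h42 i) j
      | exact congrFun (congrFun h44 i) j
  rw [hM, fromBlocks_mem_SpBig_iff] at hSp
  simp only [fromBlocks_transpose, fromBlocks_multiply, ← fromBlocks_one (l := Fin k) (m := Fin m),
    fromBlocks_inj, fromBlocks_add, transpose_zero, transpose_one, Matrix.mul_zero,
    Matrix.zero_mul, Matrix.mul_one, Matrix.one_mul, add_zero, zero_add] at hSp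
  have hcancel : ∀ X : Matrix (Fin k) (Fin m) ℝ, Aᵀ * X = 0 → X = 0 := fun X hX => by
    rw [← nonsing_inv_mul_cancel_left Aᵀ X hA', hX, Matrix.mul_zero]
  have h32 := hcancel _ hSp.1.2.1
  have h34 := hcancel _ hSp.2.1.2.1
  rw [h32, h34] at hM
  conv_rhs => rw [hM]
  simp only [kerScale, kerBlocks, one_smul, one_pow, fromBlocks_zero]
  rfl

theorem kerScale_mem {M : Matrix (FullIdx k m) (FullIdx k m) ℝ} (hM : M ∈ kerGamma k m) (t : ℝ) :
    kerScale t M ∈ kerGamma k m := by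
  have h := hM
  rw [← kerScale_one hM, kerScale, kerBlocks_mem_kerGamma_iff, kerBlocks_mem_SpBig_iff] at h
  simp only [one_smul, one_pow] at h
  obtain ⟨⟨hG, hK, hE, hC⟩, hA⟩ := h
  rw [kerScale, kerBlocks_mem_kerGamma_iff, kerBlocks_mem_SpBig_iff]
  refine ⟨⟨hG, ?_, ?_, ?_⟩, hA⟩
  · rw [transpose_smul, Matrix.smul_mul, ← smul_add, hK, smul_zero]
  · rw [transpose_smul, Matrix.smul_mul, hE]
  · simp only [transpose_smul, Matrix.smul_mul, Matrix.mul_smul, smul_smul, ← sq, ← smul_add, hC]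

theorem continuous_kerScale : Continuous fun p : ℝ × Matrix (FullIdx k m) (FullIdx k m) ℝ =>
    kerScale p.1 p.2 := by
  unfold kerScale kerBlocks blk1
  have h : ∀ {p q : ℕ} (e : Fin p → FullIdx k m) (f : Fin q → FullIdx k m),
      Continuous fun x : ℝ × Matrix (FullIdx k m) (FullIdx k m) ℝ => x.2.submatrix e f :=
    fun e f => continuous_snd.matrix_submatrix e f
  refine .matrix_fromBlocks
    (.matrix_fromBlocks (h _ _) (continuous_fst.smul (h _ _)) continuous_const continuous_const)
    (.matrix_fromBlocks ((continuous_fst.pow 2).smul (h _ _)) (continuous_fst.smul (h _ _))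
      (continuous_fst.smul (h _ _)) continuous_const) continuous_const
    (.matrix_fromBlocks (h _ _) continuous_const (continuous_fst.smul (h _ _)) continuous_const)

/-- The section `A ↦ diag(A, 1, A⁻ᵀ, 1)` of `blk1` on matrices of positive determinant. -/
noncomputable def leviEmbedding (A : Matrix (Fin k) (Fin k) ℝ) : Matrix (FullIdx k m) (FullIdx k m) ℝ :=
  kerBlocks A 0 0 0 0 (A⁻¹)ᵀ 0

theorem leviEmbedding_mem {A : Matrix (Fin k) (Fin k) ℝ} (hA : 0 < A.det) :
    leviEmbedding A ∈ kerGamma k m := by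
  rw [leviEmbedding, kerBlocks_mem_kerGamma_iff, kerBlocks_mem_SpBig_iff]
  refine ⟨⟨?_, by simp, by simp, by simp⟩, hA⟩
  rw [← transpose_mul, nonsing_inv_mul A hA.ne'.isUnit, transpose_one]

theorem kerScale_zero {M : Matrix (FullIdx k m) (FullIdx k m) ℝ} (hM : M ∈ kerGamma k m) :
    kerScale 0 M = leviEmbedding (blk1 k m M) := by
  have h := kerScale_mem hM 0
  rw [kerScale, kerBlocks_mem_kerGamma_iff, kerBlocks_mem_SpBig_iff] at h
  have hG := congrArg transpose h.1.1
  rw [transpose_mul, transpose_transpose, transpose_one] at hG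
  rw [leviEmbedding, inv_eq_left_inv hG, transpose_transpose, kerScale]
  simp

/-- The homotopy equivalence between `kerGamma k m` and `GL₊(k, ℝ)` given by `blk1`. -/
noncomputable def kerGammaHomotopyEquiv (k m : ℕ) :
    ContinuousMap.HomotopyEquiv ↥(kerGamma k m) ↥(posDet (Fin k)) where
  toFun :=
    { toFun := fun M => ⟨blk1 k m M, M.2.1.2⟩
      continuous_toFun :=
        (continuous_subtype_val.matrix_submatrix (r1 k m) (r1 k m)).subtype_mk _ }
  invFun :=
    { toFun := fun A => ⟨leviEmbedding A, leviEmbedding_mem A.2⟩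
      continuous_toFun := by
        refine Continuous.subtype_mk (.matrix_fromBlocks
          (.matrix_fromBlocks continuous_subtype_val continuous_const continuous_const
            continuous_const) continuous_const continuous_const
          (.matrix_fromBlocks continuous_inv_posDet.matrix_transpose continuous_const
            continuous_const continuous_const)) _ }
  left_inv :=
    ⟨{  toFun := fun p => ⟨kerScale p.1 p.2, kerScale_mem p.2.2 p.1⟩
        continuous_toFun := by
          refine Continuous.subtype_mk (continuous_kerScale.comp
            ((continuous_subtype_val.comp continuous_fst).prodMk
              (continuous_subtype_val.comp continuous_snd))) _
        map_zero_left := fun M => Subtype.ext (kerScale_zero M.2)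
        map_one_left := fun M => Subtype.ext (kerScale_one M.2) }⟩
  right_inv := ⟨ContinuousMap.Homotopy.refl _⟩

end KernelOfGamma

/-- Path connectedness is invariant under homotopy equivalence. -/
theorem ContinuousMap.HomotopyEquiv.pathConnectedSpace {X Y : Type*} [TopologicalSpace X]
    [TopologicalSpace Y] [PathConnectedSpace Y] (e : ContinuousMap.HomotopyEquiv X Y) :
    PathConnectedSpace X := by
  obtain ⟨H⟩ := e.left_inv
  refine ⟨PathConnectedSpace.nonempty.map e.invFun, fun x y => ?_⟩
  exact Joined.trans ⟨(H.evalAt x).symm⟩ (((PathConnectedSpace.joined (e.toFun x) (e.toFun y)).map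
    e.invFun.continuous).trans ⟨H.evalAt y⟩)

/-- `ker(γ)`, with the subspace topology from the `2ℓ × 2ℓ` real
matrices, is homotopy equivalent to `GL₊(k,ℝ)`; in particular it is connected. -/
theorem stmt13 (k m : ℕ) (hk : 1 ≤ k) :
    Nonempty (ContinuousMap.HomotopyEquiv ↥(kerGamma k m)
      ↥{A : Matrix (Fin k) (Fin k) ℝ | 0 < A.det}) ∧
    ConnectedSpace ↥(kerGamma k m) := by
  have : Nonempty (Fin k) := ⟨⟨0, hk⟩⟩
  have : PathConnectedSpace ↥(posDet (Fin k)) :=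
    isPathConnected_iff_pathConnectedSpace.mp isPathConnected_posDet
  have : PathConnectedSpace ↥(kerGamma k m) := (kerGammaHomotopyEquiv k m).pathConnectedSpace
  exact ⟨⟨kerGammaHomotopyEquiv k m⟩, inferInstance⟩
end

section
/- Let a ∈ ℝ^m with a ≠ 0, let A be an m×m real matrix, and let r > 0. Assume: for every v ∈ ℝ^m with ⟨a, v⟩ = 0 and every c ∈ ℝ, if (A − Aᵀ)v = c·a then v = 0. Define the subspaces of (ℝ^m)⁴: S₁ = {(v, rAᵀv, w, −rAᵀw) : v, w ∈ ℝ^m, ⟨a,v⟩ = ⟨a,w⟩ = 0} and S₂ = {(v, rAv, v, −rAv) : v ∈ ℝ^m} + ℝ·(0, a, 0, −a). Then S₁ ∩ S₂ = {0}, i.e. the sum S₁ + S₂ is direct. -/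
open Matrix

/-- Quadruples of vectors in `ℝ^m`, i.e. elements of `(ℝ^m)⁴`. -/
abbrev Quad (m : ℕ) := (Fin m → ℝ) × (Fin m → ℝ) × (Fin m → ℝ) × (Fin m → ℝ)

/-- Under the nondegeneracy hypothesis, the subspaces
`S₁ = {(v, rAᵀv, w, -rAᵀw) : ⟨a,v⟩ = ⟨a,w⟩ = 0}` and
`S₂ = {(v, rAv, v, -rAv) : v} + ℝ·(0, a, 0, -a)` of `(ℝ^m)⁴` intersect trivially,
i.e. their sum is direct. -/
theorem stmt15 (m : ℕ) (hm : 1 ≤ m) (a : Fin m → ℝ) (ha : a ≠ 0)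
    (A : Matrix (Fin m) (Fin m) ℝ) (r : ℝ) (hr : 0 < r)
    (hnd : ∀ (v : Fin m → ℝ) (c : ℝ), a ⬝ᵥ v = 0 → (A - Aᵀ).mulVec v = c • a → v = 0) :
    {p : Quad m | ∃ v w : Fin m → ℝ, a ⬝ᵥ v = 0 ∧ a ⬝ᵥ w = 0 ∧
        p = (v, r • Aᵀ.mulVec v, w, -(r • Aᵀ.mulVec w))} ∩
      {p : Quad m | ∃ (v : Fin m → ℝ) (c : ℝ),
        p = (v, r • A.mulVec v + c • a, v, -(r • A.mulVec v) - c • a)}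
      = {0} := by
  ext p
  simp only [Set.mem_inter_iff, Set.mem_ofPred_eq, Set.mem_singleton_iff]
  constructor
  · rintro ⟨⟨v, w, hv, -, rfl⟩, u, c, h⟩
    simp only [Prod.mk.injEq] at h
    obtain ⟨rfl, h, rfl, -⟩ := h
    have hw : w = 0 := by
      refine hnd w (-(c / r)) hv ?_
      ext i
      have hi := congrFun h i
      simp only [Pi.add_apply, Pi.smul_apply, smul_eq_mul] at hi
      simp only [Matrix.sub_mulVec, Pi.sub_apply, Pi.smul_apply, smul_eq_mul]
      field_simp
      linarith
    subst hw
    simp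
  · rintro rfl
    exact ⟨⟨0, 0, by simp [Prod.ext_iff]⟩, 0, 0, by simp [Prod.ext_iff]⟩
end

section
/- Let a, κ ∈ ℝ^m with ⟨a, κ⟩ = 1, let A be an m×m real matrix, and let r > 0. Assume: for every v ∈ ℝ^m with ⟨a, v⟩ = 0 and every c ∈ ℝ, if (A − Aᵀ)v = c·a then v = 0. Define the subspaces of (ℝ^m)⁴: N = {(v, rAᵀv, w, −rAᵀw) : ⟨a,v⟩ = ⟨a,w⟩ = 0}, V = {(v, rAv, w, −rAw) : ⟨a,v⟩ = ⟨a,w⟩ = 0}, and W = span{(κ, rAκ, 0, 0), (0, ra, 0, 0), (0, 0, 0, −ra), (0, 0, κ, −rAκ)}. Then (ℝ^m)⁴ is the internal direct sum N ⊕ V ⊕ W. -/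
open Matrix

/-- `N = {(v, rAᵀv, w, -rAᵀw) : ⟨a,v⟩ = ⟨a,w⟩ = 0}`. -/
def Nset (m : ℕ) (a : Fin m → ℝ) (A : Matrix (Fin m) (Fin m) ℝ) (r : ℝ) : Set (Quad m) :=
  {p | ∃ v w : Fin m → ℝ, a ⬝ᵥ v = 0 ∧ a ⬝ᵥ w = 0 ∧
    p = (v, r • Aᵀ.mulVec v, w, -(r • Aᵀ.mulVec w))}

/-- `V = {(v, rAv, w, -rAw) : ⟨a,v⟩ = ⟨a,w⟩ = 0}`. -/
def Vset (m : ℕ) (a : Fin m → ℝ) (A : Matrix (Fin m) (Fin m) ℝ) (r : ℝ) : Set (Quad m) :=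
  {p | ∃ v w : Fin m → ℝ, a ⬝ᵥ v = 0 ∧ a ⬝ᵥ w = 0 ∧
    p = (v, r • A.mulVec v, w, -(r • A.mulVec w))}

/-- `W = span{(κ, rAκ, 0, 0), (0, ra, 0, 0), (0, 0, 0, -ra), (0, 0, κ, -rAκ)}`. -/
def Wset (m : ℕ) (a κ : Fin m → ℝ) (A : Matrix (Fin m) (Fin m) ℝ) (r : ℝ) : Set (Quad m) :=
  {p | ∃ c₁ c₂ c₃ c₄ : ℝ,
    p = c₁ • ((κ, r • A.mulVec κ, 0, 0) : Quad m)
      + c₂ • ((0, r • a, 0, 0) : Quad m)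
      + c₃ • ((0, 0, 0, -(r • a)) : Quad m)
      + c₄ • ((0, 0, κ, -(r • A.mulVec κ)) : Quad m)}

/-- Every vector of `ℝ^m` has the form `(A - Aᵀ)v + c a` with `⟨a,v⟩ = 0`. -/
theorem exists_mulVec_add_smul_eq {m : ℕ} {a κ : Fin m → ℝ} (haκ : a ⬝ᵥ κ = 1)
    {A : Matrix (Fin m) (Fin m) ℝ}
    (hnd : ∀ (v : Fin m → ℝ) (c : ℝ), a ⬝ᵥ v = 0 → (A - Aᵀ).mulVec v = c • a → v = 0)
    (y : Fin m → ℝ) :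
    ∃ (v : Fin m → ℝ) (c : ℝ), a ⬝ᵥ v = 0 ∧ (A - Aᵀ).mulVec v + c • a = y := by
  let T : (Fin m → ℝ) →ₗ[ℝ] (Fin m → ℝ) :=
    { toFun := fun v => (A - Aᵀ).mulVec (v - (a ⬝ᵥ v) • κ) + (a ⬝ᵥ v) • a
      map_add' := fun v w => by
        simp only [dotProduct_add, mulVec_sub, mulVec_add, mulVec_smul, add_smul]
        abel
      map_smul' := fun c v => by
        simp only [dotProduct_smul, mulVec_sub, mulVec_smul, smul_eq_mul, RingHom.id_apply,
          mul_smul, smul_add, smul_sub] }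
  have hker (v : Fin m → ℝ) : a ⬝ᵥ (v - (a ⬝ᵥ v) • κ) = 0 := by
    simp [dotProduct_sub, haκ]
  have hinj : Function.Injective T := by
    rw [injective_iff_map_eq_zero]
    intro v hv
    change (A - Aᵀ).mulVec (v - (a ⬝ᵥ v) • κ) + (a ⬝ᵥ v) • a = 0 at hv
    have h0 := hnd _ (-(a ⬝ᵥ v)) (hker v) (by rw [neg_smul]; exact eq_neg_of_add_eq_zero_left hv)
    rw [h0, mulVec_zero, zero_add] at hv
    have h1 : a ⬝ᵥ v = 0 := by
      simpa [haκ] using congrArg (· ⬝ᵥ κ) hv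
    simpa [h1] using h0
  obtain ⟨v, hv⟩ := LinearMap.injective_iff_surjective.mp hinj y
  exact ⟨_, _, hker v, hv⟩

/-- Existence of the decomposition in one factor `ℝ^m × ℝ^m`. -/
theorem exists_decomposition {m : ℕ} {a κ : Fin m → ℝ} (haκ : a ⬝ᵥ κ = 1)
    {A : Matrix (Fin m) (Fin m) ℝ} {r : ℝ} (hr : r ≠ 0)
    (hnd : ∀ (v : Fin m → ℝ) (c : ℝ), a ⬝ᵥ v = 0 → (A - Aᵀ).mulVec v = c • a → v = 0)
    (x y : Fin m → ℝ) :
    ∃ (v w : Fin m → ℝ) (c d : ℝ), a ⬝ᵥ v = 0 ∧ a ⬝ᵥ w = 0 ∧ x = v + w + c • κ ∧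
      y = r • Aᵀ.mulVec v + r • A.mulVec w + c • r • A.mulVec κ + d • r • a := by
  obtain ⟨v, d, hv, h⟩ := exists_mulVec_add_smul_eq haκ hnd (A.mulVec x - r⁻¹ • y)
  refine ⟨v, x - (a ⬝ᵥ x) • κ - v, a ⬝ᵥ x, -d, hv, ?_, by abel, ?_⟩
  · simp [dotProduct_sub, haκ, hv]
  · have hy : y = r • (A.mulVec x - ((A - Aᵀ).mulVec v + d • a)) := by
      rw [h, sub_sub_cancel, smul_inv_smul₀ hr]
    rw [hy]
    simp only [mulVec_sub, mulVec_smul, sub_mulVec]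
    module

/-- Uniqueness of the decomposition in one factor `ℝ^m × ℝ^m`. -/
theorem decomposition_unique {m : ℕ} {a κ : Fin m → ℝ} (haκ : a ⬝ᵥ κ = 1)
    {A : Matrix (Fin m) (Fin m) ℝ} {r : ℝ} (hr : r ≠ 0)
    (hnd : ∀ (v : Fin m → ℝ) (c : ℝ), a ⬝ᵥ v = 0 → (A - Aᵀ).mulVec v = c • a → v = 0)
    {v w v' w' : Fin m → ℝ} {c d c' d' : ℝ}
    (hv : a ⬝ᵥ v = 0) (hw : a ⬝ᵥ w = 0) (hv' : a ⬝ᵥ v' = 0) (hw' : a ⬝ᵥ w' = 0)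
    (hx : v + w + c • κ = v' + w' + c' • κ)
    (hy : r • Aᵀ.mulVec v + r • A.mulVec w + c • r • A.mulVec κ + d • r • a =
      r • Aᵀ.mulVec v' + r • A.mulVec w' + c' • r • A.mulVec κ + d' • r • a) :
    v = v' ∧ w = w' ∧ c = c' ∧ d = d' := by
  have hc : c = c' := by
    simpa [dotProduct_add, hv, hw, hv', hw', haκ] using congrArg (a ⬝ᵥ ·) hx
  subst hc
  have hx' : v + w = v' + w' := add_right_cancel hx
  have hw_eq : w = v' + w' - v := by rw [← hx']; abel
  subst hw_eq
  have key : (A - Aᵀ).mulVec (v - v') = (d - d') • a := by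
    apply smul_right_injective _ hr
    simp only [mulVec_sub, mulVec_add, sub_mulVec] at hy ⊢
    rw [← sub_eq_zero] at hy ⊢
    rw [← neg_eq_zero, ← hy]
    module
  have h0 := hnd _ _ (by rw [dotProduct_sub, hv, hv', sub_zero]) key
  rw [h0, mulVec_zero] at key
  have hd : d - d' = 0 := by
    simpa [haκ] using (congrArg (· ⬝ᵥ κ) key).symm
  have hvv : v = v' := sub_eq_zero.mp h0
  exact ⟨hvv, by rw [hvv]; abel, rfl, sub_eq_zero.mp hd⟩

/-- Under the hypotheses `⟨a,κ⟩ = 1` and nondegeneracy,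
`(ℝ^m)⁴` is the internal direct sum `N ⊕ V ⊕ W`. -/
theorem stmt16 (m : ℕ) (hm : 1 ≤ m) (a κ : Fin m → ℝ) (haκ : a ⬝ᵥ κ = 1)
    (A : Matrix (Fin m) (Fin m) ℝ) (r : ℝ) (hr : 0 < r)
    (hnd : ∀ (v : Fin m → ℝ) (c : ℝ), a ⬝ᵥ v = 0 → (A - Aᵀ).mulVec v = c • a → v = 0) :
    (∀ z : Quad m, ∃ n ∈ Nset m a A r, ∃ v ∈ Vset m a A r, ∃ w ∈ Wset m a κ A r,
      z = n + v + w) ∧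
    (∀ n ∈ Nset m a A r, ∀ v ∈ Vset m a A r, ∀ w ∈ Wset m a κ A r,
     ∀ n' ∈ Nset m a A r, ∀ v' ∈ Vset m a A r, ∀ w' ∈ Wset m a κ A r,
      n + v + w = n' + v' + w' → n = n' ∧ v = v' ∧ w = w') := by
  constructor
  · rintro ⟨x, y, x', y'⟩
    obtain ⟨v, w, c, d, hv, hw, rfl, rfl⟩ := exists_decomposition haκ hr.ne' hnd x y
    obtain ⟨v', w', c', d', hv', hw', rfl, hy'⟩ := exists_decomposition haκ hr.ne' hnd x' (-y')
    obtain rfl := neg_eq_iff_eq_neg.mp hy'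
    refine ⟨_, ⟨v, v', hv, hv', rfl⟩, _, ⟨w, w', hw, hw', rfl⟩, _, ⟨c, d, d', c', rfl⟩, ?_⟩
    simp only [Prod.smul_mk, Prod.mk_add_mk, smul_zero, Prod.mk.injEq]
    refine ⟨?_, ?_, ?_, ?_⟩ <;> module
  · rintro _ ⟨v, p, hv, hp, rfl⟩ _ ⟨w, q, hw, hq, rfl⟩ _ ⟨c, d, e, f, rfl⟩
      _ ⟨v', p', hv', hp', rfl⟩ _ ⟨w', q', hw', hq', rfl⟩ _ ⟨c', d', e', f', rfl⟩ h
    simp only [Prod.smul_mk, Prod.mk_add_mk, smul_zero, Prod.mk.injEq, add_zero, zero_add] at h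
    obtain ⟨h1, h2, h3, h4⟩ := h
    obtain ⟨rfl, rfl, rfl, rfl⟩ := decomposition_unique haκ hr.ne' hnd hv hw hv' hw' h1
      (by simpa only [add_assoc] using h2)
    obtain ⟨rfl, rfl, rfl, rfl⟩ :=
      decomposition_unique (d := e) (d' := e') haκ hr.ne' hnd hp hq hp' hq' h3 (by
        rw [← sub_eq_zero] at h4 ⊢
        rw [← neg_eq_zero, ← h4]
        module)
    exact ⟨rfl, rfl, rfl⟩
end

section
/- Let a, κ ∈ ℝ^m with ⟨a, κ⟩ = 1, let A be an m×m real matrix with (A − Aᵀ)κ = 0, and let r > 0. Set K = {u ∈ ℝ^m : ⟨a, u⟩ = 0 and (A − Aᵀ)u = 0}, and assume ⟨κ, u⟩ = 0 for every u ∈ K. Define the subspaces of (ℝ^m)⁴: R = {(v, rAᵀv, w, −rAᵀw) : ⟨a,v⟩ = ⟨a,w⟩ = 0} + {(0, u, 0, −u) : u ∈ K} and T = {(v, rAv, v, −rAv) : v ∈ ℝ^m} + ℝ·(0, a, 0, −a). Then R ∩ T = {(u, rAu, u, −rAu) : u ∈ K}. -/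
open Matrix

/-- `K = {u : ⟨a,u⟩ = 0 and (A - Aᵀ)u = 0}`. -/
def Kset (m : ℕ) (a : Fin m → ℝ) (A : Matrix (Fin m) (Fin m) ℝ) : Set (Fin m → ℝ) :=
  {u | a ⬝ᵥ u = 0 ∧ (A - Aᵀ).mulVec u = 0}

/-- `R = {(v, rAᵀv, w, -rAᵀw) : ⟨a,v⟩ = ⟨a,w⟩ = 0} + {(0, u, 0, -u) : u ∈ K}`. -/
def Rset (m : ℕ) (a : Fin m → ℝ) (A : Matrix (Fin m) (Fin m) ℝ) (r : ℝ) : Set (Quad m) :=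
  {p | ∃ v w : Fin m → ℝ, ∃ u ∈ Kset m a A, a ⬝ᵥ v = 0 ∧ a ⬝ᵥ w = 0 ∧
    p = (v, r • Aᵀ.mulVec v + u, w, -(r • Aᵀ.mulVec w) - u)}

/-- `T = {(v, rAv, v, -rAv) : v} + ℝ·(0, a, 0, -a)`. -/
def Tset (m : ℕ) (a : Fin m → ℝ) (A : Matrix (Fin m) (Fin m) ℝ) (r : ℝ) : Set (Quad m) :=
  {p | ∃ (v : Fin m → ℝ) (c : ℝ),
    p = (v, r • A.mulVec v + c • a, v, -(r • A.mulVec v) - c • a)}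

/-- The range of the antisymmetric part of a matrix is orthogonal to its kernel. -/
theorem dotProduct_sub_transpose_mulVec_eq_zero {n : Type*} [Fintype n] (A : Matrix n n ℝ)
    {x : n → ℝ} (hx : (A - Aᵀ).mulVec x = 0) (v : n → ℝ) :
    x ⬝ᵥ (A - Aᵀ).mulVec v = 0 := by
  have hB : (A - Aᵀ)ᵀ = -(A - Aᵀ) := by simp
  rw [dotProduct_mulVec, ← mulVec_transpose, hB, neg_mulVec, hx, neg_zero, zero_dotProduct]

/-- With `⟨a,κ⟩ = 1`, `(A - Aᵀ)κ = 0`, and `κ` orthogonal to every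
element of `K`, one has `R ∩ T = {(u, rAu, u, -rAu) : u ∈ K}`. -/
theorem stmt17 (m : ℕ) (hm : 1 ≤ m) (a κ : Fin m → ℝ) (haκ : a ⬝ᵥ κ = 1)
    (A : Matrix (Fin m) (Fin m) ℝ) (hκ : (A - Aᵀ).mulVec κ = 0)
    (r : ℝ) (hr : 0 < r)
    (hKκ : ∀ u ∈ Kset m a A, κ ⬝ᵥ u = 0) :
    Rset m a A r ∩ Tset m a A r
      = {p : Quad m | ∃ u ∈ Kset m a A,
          p = (u, r • A.mulVec u, u, -(r • A.mulVec u))} := by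
  ext p
  constructor
  · rintro ⟨⟨w, v, u, hu, -, hv, rfl⟩, v', c, h⟩
    simp only [Prod.mk.injEq] at h
    obtain ⟨rfl, h, rfl, -⟩ := h
    have hu_eq : u = r • (A - Aᵀ).mulVec v + c • a := by
      rw [sub_mulVec, smul_sub, sub_add_eq_add_sub, ← h, add_sub_cancel_left]
    have hc : c = 0 := by
      have h0 := hKκ u hu
      rwa [hu_eq, dotProduct_add, dotProduct_smul, dotProduct_smul,
        dotProduct_sub_transpose_mulVec_eq_zero A hκ v,
        dotProduct_comm κ a, haκ, smul_zero, zero_add, smul_eq_mul, mul_one] at h0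
    rw [hc, zero_smul, add_zero] at hu_eq
    have hu0 : u = 0 := by
      rw [← dotProduct_self_eq_zero]
      nth_rewrite 2 [hu_eq]
      rw [dotProduct_smul, dotProduct_sub_transpose_mulVec_eq_zero A hu.2 v, smul_zero]
    have hBv : (A - Aᵀ).mulVec v = 0 :=
      (smul_eq_zero.mp (hu_eq.symm.trans hu0)).resolve_left hr.ne'
    have hAv : A.mulVec v = Aᵀ.mulVec v := by rwa [sub_mulVec, sub_eq_zero] at hBv
    exact ⟨v, ⟨hv, hBv⟩, by simp [hu0, hAv]⟩
  · rintro ⟨u, hu, rfl⟩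
    have hAu : A.mulVec u = Aᵀ.mulVec u := by
      have h := hu.2
      rwa [sub_mulVec, sub_eq_zero] at h
    exact ⟨⟨u, u, 0, by simp [Kset], hu.1, hu.1, by simp [hAu]⟩, u, 0, by simp⟩
end
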